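/- arXiv:2312.08340 — 2 statements merged into one kernel-verified Lean document; each statement's English description precedes it below -/
import Mathlib

section
/- For every α ∈ (0, 1/4) there exists k₀ such that for every integer k ≥ k₀ and every finite simple graph G with minimum degree at least k, the colouring number of the random subgraph G_{1/2} satisfies P(𝒞(G_{1/2}) ≥ (1/4 − α)·k) ≥ 1/2. -/
open scoped Classical

/-- Probability, for the random subgraph of `G` in which each edge of `G` is retained
independently with probability `p`, of the event `A`. -/
noncomputable def subgraphProb {V : Type} [Fintype V] (G : SimpleGraph V)
    (p : ℝ) (A : SimpleGraph V → Prop) : ℝ :=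
  ∑ s ∈ G.edgeSet.toFinset.powerset,
    (if A (SimpleGraph.fromEdgeSet ↑s) then
      p ^ s.card * (1 - p) ^ (G.edgeSet.toFinset.card - s.card) else 0)

/-- The colouring number of `H`: the least `t` such that every nonempty subgraph of `H`
has a vertex of degree less than `t` (it suffices to consider induced subgraphs, on a
nonempty vertex set `s`; the degree of `v ∈ s` there is the number of neighbours of `v` in `s`). -/
noncomputable def coloringNumber {V : Type} [Fintype V] (H : SimpleGraph V) : ℕ :=
  sInf {t : ℕ | ∀ s : Finset V, s.Nonempty → ∃ v ∈ s, (s.filter (fun u => H.Adj v u)).card < t}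

/-- Every nonempty vertex set has a vertex of induced degree less than the colouring number. -/
theorem coloringNumber_spec {V : Type} [Fintype V] (H : SimpleGraph V) (s : Finset V)
    (hs : s.Nonempty) :
    ∃ v ∈ s, (s.filter (fun u => H.Adj v u)).card < coloringNumber H := by
  have hne : {t : ℕ | ∀ s : Finset V, s.Nonempty →
      ∃ v ∈ s, (s.filter (fun u => H.Adj v u)).card < t}.Nonempty := by
    refine ⟨Fintype.card V + 1, fun s ⟨v, hv⟩ => ⟨v, hv, ?_⟩⟩
    exact Nat.lt_succ_of_le (Finset.card_le_univ _)
  exact Nat.sInf_mem hne s hs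

/-- The degree sum inside a vertex set `s` is at most `2 * |s|` times the colouring number. -/
theorem sum_card_filter_adj_le {V : Type} [Fintype V] (H : SimpleGraph V) (s : Finset V) :
    ∑ v ∈ s, (s.filter (fun u => H.Adj v u)).card ≤ 2 * coloringNumber H * s.card := by
  induction s using Finset.strongInduction with
  | H s ih =>
    rcases s.eq_empty_or_nonempty with rfl | hs
    · simp
    obtain ⟨v, hv, hdeg⟩ := coloringNumber_spec H s hs
    have hih := ih (s.erase v) (Finset.erase_ssubset hv)
    have hnot : v ∉ s.erase v := Finset.notMem_erase v s
    have hcard : s.card = (s.erase v).card + 1 := (Finset.card_erase_add_one hv).symm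
    have hsum : ∑ u ∈ s, (s.filter (fun w => H.Adj u w)).card =
        2 * (s.filter (fun w => H.Adj v w)).card +
          ∑ u ∈ s.erase v, ((s.erase v).filter (fun w => H.Adj u w)).card := by
      obtain ⟨r, hr, rfl⟩ : ∃ r, v ∉ r ∧ s = insert v r :=
        ⟨s.erase v, hnot, (Finset.insert_erase hv).symm⟩
      simp only [Finset.erase_insert hr, Finset.card_filter, Finset.sum_insert hr,
        SimpleGraph.irrefl, if_false, zero_add, Finset.sum_add_distrib, H.adj_comm _ v]
      ring
    rw [hsum, hcard]
    linarith

/-- A finite graph has at most `|V|` times its colouring number many edges. -/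
theorem card_edgeFinset_le_coloringNumber_mul {V : Type} [Fintype V] (H : SimpleGraph V) :
    H.edgeFinset.card ≤ coloringNumber H * Fintype.card V := by
  have h := sum_card_filter_adj_le H Finset.univ
  have h2 := H.sum_degrees_eq_twice_card_edges
  simp only [← SimpleGraph.card_neighborFinset_eq_degree,
    SimpleGraph.neighborFinset_eq_filter] at h2
  rw [h2, Finset.card_univ] at h
  linarith

/-- At least half of all subsets of a finite set contain at least half of its elements. -/
theorem two_pow_card_le_two_mul_card_filter {α : Type*} (E : Finset α) :
    2 ^ E.card ≤ 2 * (E.powerset.filter (fun s => E.card ≤ 2 * s.card)).card := by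
  have hcompl : (E.powerset.filter (fun s => ¬ E.card ≤ 2 * s.card)).card ≤
      (E.powerset.filter (fun s => E.card ≤ 2 * s.card)).card := by
    refine Finset.card_le_card_of_injOn (fun s => E \ s) ?_ ?_
    · intro s hs
      simp only [Finset.coe_filter, Finset.mem_powerset, Set.mem_ofPred_eq] at hs ⊢
      refine ⟨Finset.sdiff_subset, ?_⟩
      rw [Finset.card_sdiff_of_subset hs.1]
      omega
    · intro s hs t ht hst
      simp only [Finset.coe_filter, Finset.mem_powerset, Set.mem_ofPred_eq] at hs ht
      have hst' : E \ s = E \ t := hst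
      rw [← Finset.sdiff_sdiff_eq_self hs.1, hst', Finset.sdiff_sdiff_eq_self ht.1]
  have hsplit := Finset.card_filter_add_card_filter_not (s := E.powerset)
    (fun s => E.card ≤ 2 * s.card)
  rw [Finset.card_powerset] at hsplit
  omega

/-- An event containing every subgraph with at least half of the edges has probability
at least `1/2` at `p = 1/2`. -/
theorem half_le_subgraphProb_half {V : Type} [Fintype V] (G : SimpleGraph V)
    (A : SimpleGraph V → Prop)
    (hA : ∀ s ⊆ G.edgeSet.toFinset, G.edgeSet.toFinset.card ≤ 2 * s.card →
      A (SimpleGraph.fromEdgeSet ↑s)) :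
    (1 : ℝ) / 2 ≤ subgraphProb G (1 / 2) A := by
  unfold subgraphProb
  set E := G.edgeSet.toFinset with hE
  have hcount : (2 : ℝ) ^ E.card ≤
      2 * ((E.powerset.filter (fun s => E.card ≤ 2 * s.card)).card : ℝ) := by
    exact_mod_cast two_pow_card_le_two_mul_card_filter E
  calc (1 : ℝ) / 2 = 2 ^ E.card / 2 * (1 / 2) ^ E.card := by
        rw [div_pow, one_pow]; field_simp
    _ ≤ (E.powerset.filter (fun s => E.card ≤ 2 * s.card)).card * (1 / 2) ^ E.card := by
        gcongr; linarith
    _ = ∑ s ∈ E.powerset, if E.card ≤ 2 * s.card then (1 / 2 : ℝ) ^ E.card else 0 := by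
        rw [← Finset.sum_filter, Finset.sum_const, nsmul_eq_mul]
    _ ≤ _ := by
        refine Finset.sum_le_sum fun s hs => ?_
        have hsE := Finset.mem_powerset.1 hs
        have hpow : (1 / 2 : ℝ) ^ s.card * (1 - 1 / 2) ^ (E.card - s.card) =
            (1 / 2) ^ E.card := by
          rw [show (1 - 1 / 2 : ℝ) = 1 / 2 by norm_num, ← pow_add,
            Nat.add_sub_cancel' (Finset.card_le_card hsE)]
        rw [hpow]
        by_cases hs2 : E.card ≤ 2 * s.card
        · rw [if_pos hs2, if_pos (hA s hsE hs2)]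
        · rw [if_neg hs2]
          split_ifs <;> positivity

/-- For every `α ∈ (0, 1/4)` and all sufficiently large `k`, every (nonempty) graph `G` with
minimum degree at least `k` satisfies `P(𝒞(G_{1/2}) ≥ (1/4 - α)k) ≥ 1/2`. -/
theorem coloring_number_lower_bound_quarter (α : ℝ) (hα0 : 0 < α) (hα1 : α < 1/4) :
    ∃ k₀ : ℕ, ∀ k : ℕ, k₀ ≤ k →
      ∀ (V : Type) [Fintype V] [Nonempty V] (G : SimpleGraph V),
        (∀ v : V, k ≤ (Finset.univ.filter (fun u => G.Adj v u)).card) →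
        (1 : ℝ) / 2 ≤ subgraphProb G (1/2)
          (fun G' => (1/4 - α) * (k : ℝ) ≤ (coloringNumber G' : ℝ)) := by
  refine ⟨0, fun k _ V _ _ G hdeg => half_le_subgraphProb_half G _ fun s hs hcard => ?_⟩
  have hGE : Fintype.card V * k ≤ 2 * G.edgeSet.toFinset.card := by
    have h2 := G.sum_degrees_eq_twice_card_edges
    simp only [← SimpleGraph.card_neighborFinset_eq_degree,
      SimpleGraph.neighborFinset_eq_filter] at h2
    have h3 := Finset.card_nsmul_le_sum Finset.univ _ k fun v _ => hdeg v
    rw [h2, smul_eq_mul, Finset.card_univ] at h3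
    exact h3
  have hedge : (SimpleGraph.fromEdgeSet (s : Set (Sym2 V))).edgeFinset = s := by
    ext e
    simp only [SimpleGraph.mem_edgeFinset, SimpleGraph.edgeSet_fromEdgeSet, Set.mem_sdiff,
      Finset.mem_coe]
    exact ⟨fun h => h.1, fun h =>
      ⟨h, G.not_isDiag_of_mem_edgeSet (Set.mem_toFinset.1 (hs h))⟩⟩
  have hcol : s.card ≤
      coloringNumber (SimpleGraph.fromEdgeSet (s : Set (Sym2 V))) * Fintype.card V := by
    convert card_edgeFinset_le_coloringNumber_mul (SimpleGraph.fromEdgeSet (s : Set (Sym2 V)))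
    convert hedge.symm
  have hle : k ≤ 4 * coloringNumber (SimpleGraph.fromEdgeSet (s : Set (Sym2 V))) := by
    refine Nat.le_of_mul_le_mul_left ?_ (Fintype.card_pos (α := V))
    linarith
  have hle' : (k : ℝ) ≤ 4 * (coloringNumber (SimpleGraph.fromEdgeSet (s : Set (Sym2 V))) : ℝ) := by
    exact_mod_cast hle
  nlinarith [mul_nonneg hα0.le (Nat.cast_nonneg (α := ℝ) k)]
end

section
/- For every α > 0 and every ε > 0 there exists k₀ such that for every integer k ≥ k₀, the complete graph K_{k+1} on k + 1 vertices satisfies P(𝒞((K_{k+1})_{1/2}) ≤ (1/2 + α)·k) ≥ 1 − ε; that is, with high probability as k → ∞ the colouring number of a random subgraph of K_{k+1} obtained by keeping each edge independently with probability 1/2 is at most k/2 + o(k). -/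
open scoped Classical

/-- The second moment of the signed sum `∑ ± c e` over uniformly random signs. -/
theorem sum_powerset_signed_sq {ι : Type*} [DecidableEq ι] (E : Finset ι) (c : ι → ℝ) :
    ∑ s ∈ E.powerset, (2 * ∑ e ∈ s, c e - ∑ e ∈ E, c e) ^ 2 =
      2 ^ E.card * ∑ e ∈ E, c e ^ 2 := by
  induction E using Finset.induction_on with
  | empty => simp
  | insert a E ha ih =>
    rw [Finset.sum_powerset_insert ha, Finset.card_insert_of_notMem ha, Finset.sum_insert ha,
      Finset.sum_insert ha, ← Finset.sum_add_distrib]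
    have h : ∀ s ∈ E.powerset,
        (2 * ∑ e ∈ s, c e - (c a + ∑ e ∈ E, c e)) ^ 2 +
          (2 * ∑ e ∈ insert a s, c e - (c a + ∑ e ∈ E, c e)) ^ 2 =
        2 * (2 * ∑ e ∈ s, c e - ∑ e ∈ E, c e) ^ 2 + 2 * c a ^ 2 := by
      intro s hs
      rw [Finset.sum_insert (fun h => ha (Finset.mem_powerset.1 hs h))]
      ring
    rw [Finset.sum_congr rfl h, Finset.sum_add_distrib, ← Finset.mul_sum, ih, Finset.sum_const,
      Finset.card_powerset, nsmul_eq_mul]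
    push_cast
    ring

/-- A graph whose colouring number exceeds `t` has more than `t` vertices of degree at
least `t`. -/
theorem exists_finset_of_lt_coloringNumber {V : Type} [Fintype V] (H : SimpleGraph V) (t : ℕ)
    (ht : t < coloringNumber H) :
    ∃ s : Finset V, t < s.card ∧
      ∀ v ∈ s, t ≤ (Finset.univ.filter (fun u => H.Adj v u)).card := by
  have hmem := Nat.notMem_of_lt_sInf ht
  simp only [Set.mem_ofPred_eq, not_forall, not_exists, not_and, not_lt] at hmem
  obtain ⟨s, ⟨v, hv⟩, hs⟩ := hmem
  refine ⟨s, (hs v hv).trans_lt (Finset.card_lt_card ?_), fun w hw => (hs w hw).trans ?_⟩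
  · exact Finset.filter_ssubset.2 ⟨v, hv, H.irrefl⟩
  · exact Finset.card_le_card (Finset.filter_subset_filter _ (Finset.subset_univ s))

theorem card_adj_fromEdgeSet_le {V : Type} [Fintype V] (s : Finset (Sym2 V)) (v : V)
    {_ : DecidablePred fun u => (SimpleGraph.fromEdgeSet (s : Set (Sym2 V))).Adj v u}
    {_ : DecidablePred fun e : Sym2 V => v ∈ e} :
    (Finset.univ.filter (fun u => (SimpleGraph.fromEdgeSet (s : Set (Sym2 V))).Adj v u)).card ≤
      (s.filter (fun e => v ∈ e)).card := by
  refine Finset.card_le_card_of_injOn (fun u => s(v, u)) ?_ ?_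
  · intro u hu
    simp only [Finset.coe_filter, Finset.mem_univ, true_and, Set.mem_ofPred_eq,
      SimpleGraph.fromEdgeSet_adj, Finset.mem_coe] at hu ⊢
    exact ⟨hu.1, Sym2.mem_mk_left v u⟩
  · intro u _ w _ h
    exact Sym2.congr_right.1 h

theorem card_filter_mem_edgeSet_top (k : ℕ) (v : Fin (k + 1)) :
    ((⊤ : SimpleGraph (Fin (k + 1))).edgeSet.toFinset.filter (fun e => v ∈ e)).card = k := by
  have h : (⊤ : SimpleGraph (Fin (k + 1))).edgeSet.toFinset.filter (fun e => v ∈ e) =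
      (Finset.univ.erase v).image (fun u => s(v, u)) := by
    ext e
    simp only [Finset.mem_filter, Set.mem_toFinset, Finset.mem_image, Finset.mem_erase,
      Finset.mem_univ, and_true]
    constructor
    · rintro ⟨he, hv⟩
      obtain ⟨u, rfl⟩ := Sym2.mem_iff_exists.1 hv
      exact ⟨u, (SimpleGraph.ne_of_adj _ ((SimpleGraph.mem_edgeSet _).1 he)).symm, rfl⟩
    · rintro ⟨u, hu, rfl⟩
      exact ⟨by simpa using hu.symm, Sym2.mem_mk_left v u⟩
  rw [h, Finset.card_image_of_injective _ (fun u w h => Sym2.congr_right.1 h)]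
  simp

theorem subgraphProb_half {V : Type} [Fintype V] (G : SimpleGraph V)
    (A : SimpleGraph V → Prop) :
    subgraphProb G (1 / 2) A = 1 - (1 / 2) ^ G.edgeSet.toFinset.card *
      ((G.edgeSet.toFinset.powerset.filter
        (fun s : Finset (Sym2 V) => ¬ A (SimpleGraph.fromEdgeSet (s : Set (Sym2 V))))).card : ℝ) := by
  unfold subgraphProb
  set E := G.edgeSet.toFinset
  have h1 : ∀ s ∈ E.powerset,
      (if A (SimpleGraph.fromEdgeSet ↑s) then
        (1 / 2 : ℝ) ^ s.card * (1 - 1 / 2) ^ (E.card - s.card) else 0) =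
      (1 / 2) ^ E.card - (1 / 2) ^ E.card *
        (if ¬ A (SimpleGraph.fromEdgeSet (s : Set (Sym2 V))) then 1 else 0) := by
    intro s hs
    have hc := Finset.card_le_card (Finset.mem_powerset.1 hs)
    by_cases hA : A (SimpleGraph.fromEdgeSet (s : Set (Sym2 V)))
    · rw [if_pos hA, if_neg (not_not.2 hA), show (1 - 1 / 2 : ℝ) = 1 / 2 by norm_num, ← pow_add,
        Nat.add_sub_cancel' hc]
      ring
    · rw [if_neg hA, if_pos hA]
      ring
  rw [Finset.sum_congr rfl h1, Finset.sum_sub_distrib, ← Finset.mul_sum, Finset.sum_boole,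
    Finset.sum_const, Finset.card_powerset, nsmul_eq_mul]
  push_cast
  rw [← mul_pow]
  norm_num

/-- For every `α, ε > 0` and all sufficiently large `k`, the complete graph `K_{k+1}` satisfies
`P(𝒞((K_{k+1})_{1/2}) ≤ (1/2 + α)k) ≥ 1 - ε`. -/
theorem coloring_number_complete_graph_upper (α : ℝ) (hα : 0 < α) (ε : ℝ) (hε : 0 < ε) :
    ∃ k₀ : ℕ, ∀ k : ℕ, k₀ ≤ k →
      1 - ε ≤ subgraphProb (⊤ : SimpleGraph (Fin (k + 1))) (1/2)
        (fun G' => (coloringNumber G' : ℝ) ≤ (1/2 + α) * (k : ℝ)) := by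
  obtain ⟨k₀, hk₀⟩ := exists_nat_ge (1 + 2 / α + 4 / (ε * α ^ 2))
  refine ⟨k₀, fun k hk => ?_⟩
  have hkR : 1 + 2 / α + 4 / (ε * α ^ 2) ≤ (k : ℝ) := hk₀.trans (by exact_mod_cast hk)
  have hp1 : 0 < 2 / α := by positivity
  have hp2 : 0 < 4 / (ε * α ^ 2) := by positivity
  have hk1 : (1 : ℝ) ≤ k := by linarith
  have hk2 : 2 ≤ k * α := (div_le_iff₀ hα).1 (by linarith)
  have hk3 : 4 ≤ k * (ε * α ^ 2) := (div_le_iff₀ (by positivity)).1 (by linarith)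
  rw [subgraphProb_half]
  set E := (⊤ : SimpleGraph (Fin (k + 1))).edgeSet.toFinset
  set B := E.powerset.filter (fun s : Finset (Sym2 (Fin (k + 1))) => ¬ (coloringNumber
    (SimpleGraph.fromEdgeSet (s : Set (Sym2 (Fin (k + 1))))) : ℝ) ≤ (1/2 + α) * (k : ℝ))
  let c : Fin (k + 1) → Sym2 (Fin (k + 1)) → ℝ := fun v e => if v ∈ e then 1 else 0
  have hcE : ∀ v, ∑ e ∈ E, c v e = k := by
    intro v
    simp only [c]
    rw [Finset.sum_boole]
    exact_mod_cast card_filter_mem_edgeSet_top k v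
  have hsecond : ∑ s ∈ E.powerset, ∑ v, (2 * ∑ e ∈ s, c v e - (k : ℝ)) ^ 2 =
      2 ^ E.card * (((k : ℝ) + 1) * k) := by
    rw [Finset.sum_comm]
    have h : ∀ v ∈ (Finset.univ : Finset (Fin (k + 1))),
        ∑ s ∈ E.powerset, (2 * ∑ e ∈ s, c v e - (k : ℝ)) ^ 2 = 2 ^ E.card * (k : ℝ) := by
      intro v _
      have hm := sum_powerset_signed_sq E (c v)
      have hsq : ∀ e, c v e ^ 2 = c v e := by
        intro e
        simp only [c]
        split_ifs <;> norm_num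
      simp only [hsq, hcE] at hm
      exact hm
    rw [Finset.sum_congr rfl h, Finset.sum_const, Finset.card_univ, Fintype.card_fin,
      nsmul_eq_mul]
    push_cast
    ring
  have hlarge : ∀ s ∈ B, (k : ℝ) / 2 * (k * α) ^ 2 ≤ ∑ v, (2 * ∑ e ∈ s, c v e - (k : ℝ)) ^ 2 := by
    intro s hs
    have hlt := (Finset.mem_filter.1 hs).2
    have hnn : 0 ≤ (1/2 + α) * (k : ℝ) := by positivity
    rw [not_le, ← Nat.floor_lt hnn] at hlt
    obtain ⟨S, hS, hdeg⟩ := exists_finset_of_lt_coloringNumber _ _ hlt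
    have hScard : (k : ℝ) / 2 ≤ S.card := by
      have := (Nat.floor_lt hnn).1 hS
      nlinarith
    have hv : ∀ v ∈ S, (k * α) ^ 2 ≤ (2 * ∑ e ∈ s, c v e - (k : ℝ)) ^ 2 := by
      intro v hv
      have hle : (⌊(1/2 + α) * (k : ℝ)⌋₊ : ℝ) ≤ ∑ e ∈ s, c v e := by
        simp only [c]
        rw [Finset.sum_boole]
        refine Nat.cast_le.2 ((hdeg v hv).trans (card_adj_fromEdgeSet_le s v))
      have hfl := Nat.lt_floor_add_one ((1/2 + α) * (k : ℝ))
      exact pow_le_pow_left₀ (by positivity) (by linarith) 2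
    calc (k : ℝ) / 2 * (k * α) ^ 2 ≤ S.card * (k * α) ^ 2 := by gcongr
      _ = ∑ v ∈ S, (k * α) ^ 2 := by rw [Finset.sum_const, nsmul_eq_mul]
      _ ≤ ∑ v ∈ S, (2 * ∑ e ∈ s, c v e - (k : ℝ)) ^ 2 := Finset.sum_le_sum hv
      _ ≤ _ := Finset.sum_le_sum_of_subset_of_nonneg (Finset.subset_univ S)
        (fun _ _ _ => sq_nonneg _)
  have hmarkov : (B.card : ℝ) * (k / 2 * (k * α) ^ 2) ≤ 2 ^ E.card * ((k + 1) * k) := by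
    rw [← hsecond, ← nsmul_eq_mul, ← Finset.sum_const]
    exact (Finset.sum_le_sum hlarge).trans (Finset.sum_le_sum_of_subset_of_nonneg
      (Finset.filter_subset _ _) (fun _ _ _ => Finset.sum_nonneg fun _ _ => sq_nonneg _))
  have hBle : (B.card : ℝ) ≤ 2 ^ E.card * ε := by
    have hpos : 0 < (k : ℝ) / 2 * (k * α) ^ 2 := by positivity
    refine le_of_mul_le_mul_right (hmarkov.trans ?_) hpos
    rw [mul_assoc]
    refine mul_le_mul_of_nonneg_left ?_ (by positivity)
    nlinarith [mul_le_mul_of_nonneg_left hk3 (by positivity : (0 : ℝ) ≤ k ^ 2)]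
  have hfin : (1 / 2 : ℝ) ^ E.card * B.card ≤ ε := by
    rw [one_div, inv_pow, inv_mul_le_iff₀ (by positivity)]
    exact hBle
  convert sub_le_sub_left hfin 1
end
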